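/- arXiv:1709.00263 — 2 statements merged into one kernel-verified Lean document; each statement's English description precedes it below -/
import Mathlib

section
/- Assume q ≥ m. For α ∈ Z^m, α belongs to Γ̂(Q) if and only if the divisor D_α is a discrepancy with respect to every pair of distinct points in {Q_1, ..., Q_m}. -/
open scoped Classical

/-- Abstract divisor-theoretic data of a nonsingular, projective, geometrically
irreducible algebraic curve over a field `Fq`: a function field `K`, a set of
closed points with their degrees, a genus, and the normalized discrete
valuations of `K` at the closed points (with the junk convention `v P 0 = 0`). -/
structure Curve (Fq : Type) [Field Fq] where
  /-- the function field of the curve -/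
  K : Type
  [fieldK : Field K]
  [algebraK : Algebra Fq K]
  /-- the closed points of the curve -/
  Point : Type
  /-- the degree of a closed point -/
  deg : Point → ℕ
  deg_pos : ∀ P, 0 < deg P
  /-- the genus of the curve -/
  genus : ℕ
  /-- the normalized discrete valuation at a closed point -/
  v : Point → K → ℤ
  v_zero : ∀ P, v P 0 = 0
  v_mul : ∀ (P : Point) {x y : K}, x ≠ 0 → y ≠ 0 → v P (x * y) = v P x + v P y
  v_min_le_add : ∀ (P : Point) {x y : K}, x ≠ 0 → y ≠ 0 → x + y ≠ 0 →
    min (v P x) (v P y) ≤ v P (x + y)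
  v_algebraMap : ∀ (P : Point) (c : Fq), c ≠ 0 → v P (algebraMap Fq K c) = 0
  v_surjective : ∀ P : Point, ∃ x : K, x ≠ 0 ∧ v P x = 1
  /-- a nonzero function has only finitely many zeros and poles -/
  support_finite : ∀ {x : K}, x ≠ 0 → {P : Point | v P x ≠ 0}.Finite
  /-- a function without poles is constant (the curve is projective and
  geometrically irreducible) -/
  no_pole_constant : ∀ {x : K}, x ≠ 0 → (∀ P, 0 ≤ v P x) → ∃ c : Fq, x = algebraMap Fq K c
  /-- principal divisors have degree zero -/
  degree_principal : ∀ {x : K}, x ≠ 0 → ∑ᶠ P : Point, (deg P : ℤ) * v P x = 0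

attribute [instance] Curve.fieldK Curve.algebraK

namespace Curve

variable {Fq : Type} [Field Fq] [Fintype Fq]

/-- The degree of a divisor. -/
noncomputable def degDiv (C : Curve Fq) (D : C.Point →₀ ℤ) : ℤ :=
  D.sum fun P n => (C.deg P : ℤ) * n

/-- The Riemann–Roch space `L(D)`. -/
def Lset (C : Curve Fq) (D : C.Point →₀ ℤ) : Set C.K :=
  {h | h = 0 ∨ ∀ P : C.Point, 0 ≤ C.v P h + D P}

/-- `ℓ(D)`, the dimension of `L(D)` as an `Fq`-vector space. -/
noncomputable def ell (C : Curve Fq) (D : C.Point →₀ ℤ) : ℕ :=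
  Module.finrank Fq (Submodule.span Fq (C.Lset D))

/-- The divisor `D` is principal. -/
def IsPrincipalDiv (C : Curve Fq) (D : C.Point →₀ ℤ) : Prop :=
  ∃ h : C.K, h ≠ 0 ∧ ∀ P : C.Point, C.v P h = D P

/-- The divisor `D_α = α₁Q₁ + ⋯ + α_mQ_m`. -/
noncomputable def Dt (C : Curve Fq) {m : ℕ} (Q : Fin m → C.Point) (α : Fin m → ℤ) :
    C.Point →₀ ℤ :=
  ∑ i, Finsupp.single (Q i) (α i)

/-- The generalized Weierstrass semigroup `Ĥ(Q)`: the set of tuples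
`(-v_{Q_1}(h), …, -v_{Q_m}(h))` for nonzero `h` having poles only in `{Q_1, …, Q_m}`. -/
def Hhat (C : Curve Fq) {m : ℕ} (Q : Fin m → C.Point) : Set (Fin m → ℤ) :=
  {α | ∃ h : C.K, h ≠ 0 ∧ (∀ P : C.Point, P ∉ Set.range Q → 0 ≤ C.v P h) ∧
    ∀ i, α i = -C.v (Q i) h}

/-- `∇_J(α)`. -/
def nabla (C : Curve Fq) {m : ℕ} (Q : Fin m → C.Point) (J : Set (Fin m))
    (α : Fin m → ℤ) : Set (Fin m → ℤ) :=
  {β | β ∈ C.Hhat Q ∧ (∀ j ∈ J, β j = α j) ∧ ∀ i ∉ J, β i < α i}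

/-- `∇_i^m(α)`. -/
def nablaI (C : Curve Fq) {m : ℕ} (Q : Fin m → C.Point) (i : Fin m) (α : Fin m → ℤ) :
    Set (Fin m → ℤ) :=
  {β | β ∈ C.Hhat Q ∧ β i = α i ∧ ∀ j, j ≠ i → β j ≤ α j}

/-- `Γ̂(Q)`, the set of absolute maximal elements of `Ĥ(Q)`. -/
def Gammahat (C : Curve Fq) {m : ℕ} (Q : Fin m → C.Point) : Set (Fin m → ℤ) :=
  {α | α ∈ C.Hhat Q ∧
    ∀ J : Set (Fin m), J.Nonempty → J ≠ Set.univ → C.nabla Q J α = ∅}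

/-- `Γ̂_Q(α) = {β ∈ Γ̂(Q) : β ≤ α}`. -/
def GammahatLe (C : Curve Fq) {m : ℕ} (Q : Fin m → C.Point) (α : Fin m → ℤ) :
    Set (Fin m → ℤ) :=
  {β | β ∈ C.Gammahat Q ∧ ∀ i, β i ≤ α i}

/-- The divisor `A` is a discrepancy with respect to `P` and `Q'`. -/
def IsDiscrepancy (C : Curve Fq) (A : C.Point →₀ ℤ) (P Q' : C.Point) : Prop :=
  C.Lset A ≠ C.Lset (A - Finsupp.single Q' 1) ∧
  C.Lset (A - Finsupp.single P 1) = C.Lset (A - Finsupp.single P 1 - Finsupp.single Q' 1)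

/-- `T_α = {β ∈ ℤ^m : β ≤ α and ℓ(D_β) = ℓ(D_α)}`. -/
def Tset (C : Curve Fq) {m : ℕ} (Q : Fin m → C.Point) (α : Fin m → ℤ) :
    Set (Fin m → ℤ) :=
  {β | (∀ j, β j ≤ α j) ∧ C.ell (C.Dt Q β) = C.ell (C.Dt Q α)}

/-- `D_β` is the supported floor `⌊D_α⌋_Q`: `β` is the element of `T_α` of minimum
norm `|β| = β₁ + ⋯ + β_m`. -/
def IsSuppFloor (C : Curve Fq) {m : ℕ} (Q : Fin m → C.Point) (α β : Fin m → ℤ) : Prop :=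
  β ∈ C.Tset Q α ∧ ∀ γ ∈ C.Tset Q α, ∑ i, β i ≤ ∑ i, γ i

/-- `G'` is the floor `⌊G⌋` of `G`: among all divisors with the same Riemann–Roch
space as `G`, it has minimum degree. -/
def IsFloorDiv (C : Curve Fq) (G G' : C.Point →₀ ℤ) : Prop :=
  C.Lset G' = C.Lset G ∧
  ∀ G'' : C.Point →₀ ℤ, C.Lset G'' = C.Lset G → C.degDiv G' ≤ C.degDiv G''

end Curve

namespace Curve

theorem Dt_apply {Fq : Type} [Field Fq] [Fintype Fq] (C : Curve Fq) {m : ℕ}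
    {Q : Fin m → C.Point} (hQ : Function.Injective Q) (α : Fin m → ℤ) (i : Fin m) :
    C.Dt Q α (Q i) = α i := by
  simp [Dt, Finsupp.finsetSum_apply, Finsupp.single_apply, hQ.eq_iff]

theorem Dt_apply_of_notMem {Fq : Type} [Field Fq] [Fintype Fq] (C : Curve Fq) {m : ℕ}
    {Q : Fin m → C.Point} (α : Fin m → ℤ) {P : C.Point} (hP : P ∉ Set.range Q) :
    C.Dt Q α P = 0 := by
  rw [Dt, Finsupp.finsetSum_apply]
  refine Finset.sum_eq_zero fun i _ => Finsupp.single_eq_of_ne ?_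
  rintro rfl
  exact hP ⟨i, rfl⟩

theorem Lset_sub_single_subset {Fq : Type} [Field Fq] [Fintype Fq] (C : Curve Fq)
    (A : C.Point →₀ ℤ) (P : C.Point) :
    C.Lset (A - Finsupp.single P 1) ⊆ C.Lset A := by
  rintro f (hf | hf)
  · exact Or.inl hf
  · refine Or.inr fun R => ?_
    have h := hf R
    rw [Finsupp.sub_apply, Finsupp.single_apply] at h
    split_ifs at h <;> omega

/-- `L(A) = L(A - P)` exactly when no nonzero element of `L(A)` has valuation `-A(P)` at `P`. -/
theorem Lset_eq_sub_single_iff {Fq : Type} [Field Fq] [Fintype Fq] (C : Curve Fq)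
    (A : C.Point →₀ ℤ) (P : C.Point) :
    C.Lset A = C.Lset (A - Finsupp.single P 1) ↔
      ∀ f : C.K, f ≠ 0 → (∀ R, 0 ≤ C.v R f + A R) → C.v P f + A P ≠ 0 := by
  constructor
  · intro h f hf0 hf hP
    have hmem : f ∈ C.Lset (A - Finsupp.single P 1) := h ▸ Or.inr hf
    have hP' := (hmem.resolve_left hf0) P
    rw [Finsupp.sub_apply, Finsupp.single_eq_same] at hP'
    omega
  · intro h
    refine Set.Subset.antisymm (fun f hf => ?_) (C.Lset_sub_single_subset A P)
    by_cases hf0 : f = 0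
    · exact Or.inl hf0
    have hf' := hf.resolve_left hf0
    refine Or.inr fun R => ?_
    have hR := hf' R
    have hP := h f hf0 hf'
    rw [Finsupp.sub_apply, Finsupp.single_apply]
    split_ifs with hPR
    · subst hPR
      omega
    · omega

/-- A nonzero function lies in `L(D_α)` exactly when it is regular outside `Q` and its pole
orders along `Q` are bounded by `α`. -/
theorem forall_nonneg_Dt_iff {Fq : Type} [Field Fq] [Fintype Fq] (C : Curve Fq) {m : ℕ}
    {Q : Fin m → C.Point} (hQ : Function.Injective Q) (α : Fin m → ℤ) (f : C.K) :
    (∀ R, 0 ≤ C.v R f + C.Dt Q α R) ↔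
      (∀ P, P ∉ Set.range Q → 0 ≤ C.v P f) ∧ ∀ k, -C.v (Q k) f ≤ α k := by
  constructor
  · refine fun h => ⟨fun P hP => ?_, fun k => ?_⟩
    · simpa [C.Dt_apply_of_notMem α hP] using h P
    · have hk := h (Q k)
      rw [C.Dt_apply hQ] at hk
      omega
  · rintro ⟨h₁, h₂⟩ R
    by_cases hR : R ∈ Set.range Q
    · obtain ⟨k, rfl⟩ := hR
      have hk := h₂ k
      rw [C.Dt_apply hQ]
      omega
    · simpa [C.Dt_apply_of_notMem α hR] using h₁ R hR

theorem Dt_sub_single {Fq : Type} [Field Fq] [Fintype Fq] (C : Curve Fq) {m : ℕ}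
    (Q : Fin m → C.Point) (α : Fin m → ℤ) (i : Fin m) :
    C.Dt Q α - Finsupp.single (Q i) 1 = C.Dt Q (α - Pi.single i 1) := by
  have h : Finsupp.single (Q i) (1 : ℤ) = C.Dt Q (Pi.single i 1) := by
    rw [Dt, Finset.sum_eq_single i]
    · simp
    · intro k _ hk
      simp [hk]
    · simp
  rw [h]
  simp [Dt, Finsupp.single_sub]

theorem Dt_isDiscrepancy_iff {Fq : Type} [Field Fq] [Fintype Fq] (C : Curve Fq) {m : ℕ}
    {Q : Fin m → C.Point} (hQ : Function.Injective Q) (α : Fin m → ℤ) {i j : Fin m}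
    (hij : i ≠ j) :
    C.IsDiscrepancy (C.Dt Q α) (Q i) (Q j) ↔
      (∃ f : C.K, f ≠ 0 ∧ (∀ P, P ∉ Set.range Q → 0 ≤ C.v P f) ∧
        (∀ k, -C.v (Q k) f ≤ α k) ∧ -C.v (Q j) f = α j) ∧
      ∀ f : C.K, f ≠ 0 → (∀ P, P ∉ Set.range Q → 0 ≤ C.v P f) →
        (∀ k, -C.v (Q k) f ≤ α k) → -C.v (Q i) f < α i → -C.v (Q j) f ≠ α j := by
  rw [IsDiscrepancy, Ne, Lset_eq_sub_single_iff, C.Dt_sub_single, Lset_eq_sub_single_iff]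
  simp only [C.forall_nonneg_Dt_iff hQ, C.Dt_apply hQ]
  push Not
  refine and_congr ?_ ?_
  · refine exists_congr fun f => and_congr_right fun _ => ?_
    rw [and_assoc]
    refine and_congr_right fun _ => and_congr_right fun _ => ?_
    omega
  · refine forall_congr' fun f => forall_congr' fun _ => ?_
    rw [and_imp]
    refine forall_congr' fun _ => ?_
    have hj : (α - Pi.single i 1 : Fin m → ℤ) j = α j := by simp [hij.symm]
    have hle : (∀ k, -C.v (Q k) f ≤ (α - Pi.single i 1 : Fin m → ℤ) k) ↔
        (∀ k, -C.v (Q k) f ≤ α k) ∧ -C.v (Q i) f < α i := by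
      constructor
      · refine fun h => ⟨fun k => (h k).trans ?_, ?_⟩
        · by_cases hk : k = i <;> simp [hk]
        · have hi := h i
          simp only [Pi.sub_apply, Pi.single_eq_same] at hi
          omega
      · rintro ⟨h, hi⟩ k
        by_cases hk : k = i
        · subst hk
          simp only [Pi.sub_apply, Pi.single_eq_same]
          omega
        · simpa [hk] using h k
    rw [hj, hle, and_imp]
    refine forall_congr' fun _ => forall_congr' fun _ => not_congr ?_
    omega

end Curve

/-- Proposition 2.7: assume `q ≥ m`.  For `α ∈ ℤ^m`, `α` belongs to
`Γ̂(Q)` if and only if `D_α` is a discrepancy with respect to every pair of distinct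
points in `{Q_1, …, Q_m}`. -/
theorem statement0 {Fq : Type} [Field Fq] [Fintype Fq] (C : Curve Fq)
    (hgenus : 0 < C.genus) (K₀ : C.Point →₀ ℤ)
    (hRR : ∀ D : C.Point →₀ ℤ,
      (C.ell D : ℤ) - C.ell (K₀ - D) = C.degDiv D + 1 - C.genus)
    {m : ℕ} (hm : 2 ≤ m) (Q : Fin m → C.Point)
    (hQinj : Function.Injective Q) (hQdeg : ∀ i, C.deg (Q i) = 1)
    (hq : m ≤ Fintype.card Fq) (α : Fin m → ℤ) :
    α ∈ C.Gammahat Q ↔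
      ∀ i j : Fin m, i ≠ j → C.IsDiscrepancy (C.Dt Q α) (Q i) (Q j) := by
  constructor
  · rintro ⟨⟨h, h0, hreg, hα⟩, hmax⟩ i j hij
    refine (C.Dt_isDiscrepancy_iff hQinj α hij).2
      ⟨⟨h, h0, hreg, fun k => (hα k).ge, (hα j).symm⟩, fun f hf0 hfreg hle hi hj => ?_⟩
    have hempty := hmax {k | -C.v (Q k) f = α k} ⟨j, hj⟩
      ((Set.ne_univ_iff_exists_notMem _).2 ⟨i, hi.ne⟩)
    exact Set.eq_empty_iff_forall_notMem.1 hempty (fun k => -C.v (Q k) f)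
      ⟨⟨f, hf0, hfreg, fun _ => rfl⟩, fun _ hk => hk, fun k hk => lt_of_le_of_ne (hle k) hk⟩
  · intro hdisc
    have hiff := fun i j hij => (C.Dt_isDiscrepancy_iff hQinj α hij).1 (hdisc i j hij)
    refine ⟨?_, fun J ⟨j, hj⟩ hJ => ?_⟩
    · have hne : (⟨0, by omega⟩ : Fin m) ≠ ⟨1, by omega⟩ := by simp
      obtain ⟨f, hf0, hreg, hle, hj⟩ := (hiff _ _ hne).1
      refine ⟨f, hf0, hreg, fun k => ?_⟩
      by_contra hk
      have hlt : -C.v (Q k) f < α k := lt_of_le_of_ne (hle k) (Ne.symm hk)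
      have hkj : k ≠ ⟨1, by omega⟩ := fun h => hk (h ▸ hj.symm)
      exact (hiff _ _ hkj).2 f hf0 hreg hle hlt hj
    · obtain ⟨i, hi⟩ := (Set.ne_univ_iff_exists_notMem J).1 hJ
      refine Set.eq_empty_iff_forall_notMem.2 ?_
      rintro β ⟨⟨f, hf0, hreg, hβ⟩, heq, hlt⟩
      have hij : i ≠ j := by
        rintro rfl
        exact hi hj
      refine (hiff i j hij).2 f hf0 hreg (fun k => ?_) (hβ i ▸ hlt i hi) (hβ j ▸ heq j hj)
      rw [← hβ k]
      by_cases hk : k ∈ J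
      · exact (heq k hk).le
      · exact (hlt k hk).le
end

section
/- Assume q ≥ m and let α ∈ Z^m with ℓ(D_α) > 0. If ⌊D_α⌋_Q = D_β, then β ∈ Ĥ(Q); in particular, if α ∈ Ĥ(Q) then ⌊D_α⌋_Q = D_α. -/
open scoped Classical

/-- A vector space over a finite field is not the union of at most `|k|` proper subspaces. -/
theorem exists_mem_forall_notMem_of_card_le {k M ι : Type*} [Field k] [Fintype k]
    [AddCommGroup M] [Module k M] (V : Submodule k M) (W : ι → Submodule k M) (s : Finset ι)
    (hs : s.card ≤ Fintype.card k) (hW : ∀ i ∈ s, ∃ x ∈ V, x ∉ W i) :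
    ∃ x ∈ V, ∀ i ∈ s, x ∉ W i := by
  induction s using Finset.induction_on with
  | empty => exact ⟨0, V.zero_mem, by simp⟩
  | insert a t ha ih =>
    rw [Finset.card_insert_of_notMem ha] at hs
    obtain ⟨x, hxV, hx⟩ := ih (by omega) fun i hi => hW i (Finset.mem_insert_of_mem hi)
    by_cases hxa : x ∈ W a
    · obtain ⟨y, hyV, hy⟩ := hW a (Finset.mem_insert_self a t)
      obtain ⟨c, hc⟩ : ∃ c : k, ∀ i ∈ t, y + c • x ∉ W i := by
        by_contra! h
        choose f hft hfW using h
        obtain ⟨c, -, d, -, hcd, hf⟩ :=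
          Finset.exists_ne_map_eq_of_card_lt_of_maps_to (s := Finset.univ) (t := t) (f := f)
            (by rw [Finset.card_univ]; omega) (fun c _ => hft c)
        have hsub : (c - d) • x ∈ W (f c) := by
          have := (W (f c)).sub_mem (hfW c) (hf ▸ hfW d)
          rwa [add_sub_add_left_eq_sub, ← sub_smul] at this
        exact hx _ (hft c) (((W (f c)).smul_mem_iff (sub_ne_zero.2 hcd)).1 hsub)
      refine ⟨y + c • x, V.add_mem hyV (V.smul_mem c hxV), fun i hi => ?_⟩
      rcases Finset.mem_insert.1 hi with rfl | hi
      · exact fun h => hy (((W i).add_mem_iff_left ((W i).smul_mem c hxa)).1 h)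
      · exact hc i hi
    · refine ⟨x, hxV, fun i hi => ?_⟩
      rcases Finset.mem_insert.1 hi with rfl | hi
      · exact hxa
      · exact hx i hi

namespace Curve

variable {Fq : Type} [Field Fq]

/-- The Riemann–Roch space `L(D)` as an `Fq`-subspace of the function field. -/
def rrSpace (C : Curve Fq) (D : C.Point →₀ ℤ) : Submodule Fq C.K where
  carrier := C.Lset D
  zero_mem' := Or.inl rfl
  add_mem' := by
    intro x y hx hy
    by_cases hx0 : x = 0
    · simpa [hx0] using hy
    by_cases hy0 : y = 0
    · simpa [hy0] using hx
    by_cases hxy : x + y = 0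
    · exact Or.inl hxy
    refine Or.inr fun P => ?_
    have h1 := hx.resolve_left hx0 P
    have h2 := hy.resolve_left hy0 P
    have h3 := C.v_min_le_add P hx0 hy0 hxy
    omega
  smul_mem' := by
    intro c x hx
    rcases eq_or_ne c 0 with rfl | hc
    · exact Or.inl (zero_smul _ _)
    rcases hx with rfl | hx
    · exact Or.inl (smul_zero _)
    by_cases hx0 : x = 0
    · exact Or.inl (by rw [hx0, smul_zero])
    refine Or.inr fun P => ?_
    have hc' : algebraMap Fq C.K c ≠ 0 := by simpa using hc
    rw [Algebra.smul_def, C.v_mul P hc' hx0, C.v_algebraMap P c hc, zero_add]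
    exact hx P

theorem mem_rrSpace (C : Curve Fq) {D : C.Point →₀ ℤ} {h : C.K} :
    h ∈ C.rrSpace D ↔ h = 0 ∨ ∀ P, 0 ≤ C.v P h + D P :=
  Iff.rfl

theorem ell_eq_finrank_rrSpace [Fintype Fq] (C : Curve Fq) (D : C.Point →₀ ℤ) :
    C.ell D = Module.finrank Fq (C.rrSpace D) := by
  change Module.finrank Fq (Submodule.span Fq (C.rrSpace D : Set C.K)) = _
  rw [Submodule.span_eq]

theorem rrSpace_mono (C : Curve Fq) {D E : C.Point →₀ ℤ} (h : D ≤ E) :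
    C.rrSpace D ≤ C.rrSpace E := by
  rintro x (hx | hx)
  · exact Or.inl hx
  · exact Or.inr fun P => (hx P).trans (add_le_add_right (h P) _)

theorem rrSpace_eq_of_le_of_ell_eq [Fintype Fq] (C : Curve Fq) {D E : C.Point →₀ ℤ}
    (h : D ≤ E) (hE : 0 < C.ell E) (hell : C.ell D = C.ell E) :
    C.rrSpace D = C.rrSpace E := by
  rw [ell_eq_finrank_rrSpace] at hE
  rw [ell_eq_finrank_rrSpace, ell_eq_finrank_rrSpace] at hell
  have : FiniteDimensional Fq (C.rrSpace E) := Module.finite_of_finrank_pos hE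
  exact Submodule.eq_of_le_of_finrank_eq (C.rrSpace_mono h) hell

variable {m : ℕ}

theorem Dt_apply_self (C : Curve Fq) {Q : Fin m → C.Point} (hQ : Function.Injective Q)
    (α : Fin m → ℤ) (i : Fin m) : C.Dt Q α (Q i) = α i := by
  simp [Dt, Finsupp.finsetSum_apply, Finsupp.single_apply, hQ.eq_iff]

theorem Dt_apply_of_notMem_range (C : Curve Fq) {Q : Fin m → C.Point} (α : Fin m → ℤ)
    {P : C.Point} (hP : P ∉ Set.range Q) : C.Dt Q α P = 0 := by
  rw [Dt, Finsupp.finsetSum_apply]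
  exact Finset.sum_eq_zero fun i _ => Finsupp.single_eq_of_ne fun h => hP ⟨i, h.symm⟩

theorem Dt_mono (C : Curve Fq) (Q : Fin m → C.Point) : Monotone (C.Dt Q) :=
  fun _ _ h => Finset.sum_le_sum fun i _ => Finsupp.single_le_single.2 (h i)

theorem mem_rrSpace_Dt_iff (C : Curve Fq) {Q : Fin m → C.Point} (hQ : Function.Injective Q)
    {α : Fin m → ℤ} {h : C.K} (h0 : h ≠ 0) :
    h ∈ C.rrSpace (C.Dt Q α) ↔
      (∀ P ∉ Set.range Q, 0 ≤ C.v P h) ∧ ∀ i, 0 ≤ C.v (Q i) h + α i := by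
  rw [mem_rrSpace, or_iff_right h0]
  constructor
  · intro H
    refine ⟨fun P hP => ?_, fun i => ?_⟩
    · simpa [C.Dt_apply_of_notMem_range α hP] using H P
    · simpa [C.Dt_apply_self hQ] using H (Q i)
  · rintro ⟨H1, H2⟩ P
    by_cases hP : P ∈ Set.range Q
    · obtain ⟨i, rfl⟩ := hP
      simpa [C.Dt_apply_self hQ] using H2 i
    · simpa [C.Dt_apply_of_notMem_range α hP] using H1 P hP

/-- If `L(D_β - Q_i)` is strictly smaller than `L(D_β)` for every `i`, then `β ∈ Ĥ(Q)`. -/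
theorem mem_Hhat_of_forall_exists_notMem [Fintype Fq] (C : Curve Fq) {Q : Fin m → C.Point}
    (hQ : Function.Injective Q) (hm : 0 < m) (hq : m ≤ Fintype.card Fq) {β : Fin m → ℤ}
    (hβ : ∀ i, ∃ x ∈ C.rrSpace (C.Dt Q β), x ∉ C.rrSpace (C.Dt Q (β - Pi.single i 1))) :
    β ∈ C.Hhat Q := by
  obtain ⟨h, hV, hW⟩ := exists_mem_forall_notMem_of_card_le (C.rrSpace (C.Dt Q β))
    (fun i => C.rrSpace (C.Dt Q (β - Pi.single i 1))) Finset.univ (by simpa using hq)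
    fun i _ => hβ i
  have h0 : h ≠ 0 := by
    rintro rfl
    exact hW ⟨0, hm⟩ (Finset.mem_univ _) (Submodule.zero_mem _)
  obtain ⟨hreg, hpole⟩ := (C.mem_rrSpace_Dt_iff hQ h0).1 hV
  refine ⟨h, h0, hreg, fun i => ?_⟩
  by_contra hne
  refine hW i (Finset.mem_univ _) ((C.mem_rrSpace_Dt_iff hQ h0).2 ⟨hreg, fun j => ?_⟩)
  have := hpole j
  rcases eq_or_ne j i with rfl | hji
  · rw [Pi.sub_apply, Pi.single_eq_same]
    omega
  · rwa [Pi.sub_apply, Pi.single_eq_of_ne hji, sub_zero]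

theorem IsSuppFloor.exists_notMem_rrSpace [Fintype Fq] {C : Curve Fq} {Q : Fin m → C.Point}
    {α β : Fin m → ℤ} (hβ : C.IsSuppFloor Q α β) (i : Fin m) :
    ∃ x ∈ C.rrSpace (C.Dt Q β), x ∉ C.rrSpace (C.Dt Q (β - Pi.single i 1)) := by
  by_contra! hle
  have hsub : β - Pi.single i 1 ≤ β := sub_le_self _ (Pi.single_nonneg.2 zero_le_one)
  have hmem : β - Pi.single i 1 ∈ C.Tset Q α := by
    refine ⟨fun j => (hsub j).trans (hβ.1.1 j), ?_⟩
    rw [← hβ.1.2, ell_eq_finrank_rrSpace, ell_eq_finrank_rrSpace,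
      le_antisymm (C.rrSpace_mono (C.Dt_mono Q hsub)) hle]
  have := hβ.2 _ hmem
  simp [Finset.sum_sub_distrib] at this

theorem isSuppFloor_self_of_mem_Hhat [Fintype Fq] {C : Curve Fq} {Q : Fin m → C.Point}
    (hQ : Function.Injective Q) {α : Fin m → ℤ} (hα : 0 < C.ell (C.Dt Q α))
    (hH : α ∈ C.Hhat Q) : C.IsSuppFloor Q α α := by
  refine ⟨⟨fun _ => le_rfl, rfl⟩, fun γ hγ => Finset.sum_le_sum fun i _ => ?_⟩
  obtain ⟨h, h0, hreg, hv⟩ := hH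
  have hmem : h ∈ C.rrSpace (C.Dt Q α) :=
    (C.mem_rrSpace_Dt_iff hQ h0).2 ⟨hreg, fun j => by rw [hv j]; omega⟩
  rw [← C.rrSpace_eq_of_le_of_ell_eq (C.Dt_mono Q hγ.1) hα hγ.2] at hmem
  have := ((C.mem_rrSpace_Dt_iff hQ h0).1 hmem).2 i
  have := hv i
  omega

end Curve

/-- Lemma 3.5(1): assume `q ≥ m` and `ℓ(D_α) > 0`.  If
`⌊D_α⌋_Q = D_β` then `β ∈ Ĥ(Q)`; in particular `⌊D_α⌋_Q = D_α` provided
`α ∈ Ĥ(Q)`. -/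
theorem statement2 {Fq : Type} [Field Fq] [Fintype Fq] (C : Curve Fq)
    (hgenus : 0 < C.genus) (K₀ : C.Point →₀ ℤ)
    (hRR : ∀ D : C.Point →₀ ℤ,
      (C.ell D : ℤ) - C.ell (K₀ - D) = C.degDiv D + 1 - C.genus)
    {m : ℕ} (hm : 2 ≤ m) (Q : Fin m → C.Point)
    (hQinj : Function.Injective Q) (hQdeg : ∀ i, C.deg (Q i) = 1)
    (hq : m ≤ Fintype.card Fq)
    (α : Fin m → ℤ) (hα : 0 < C.ell (C.Dt Q α)) :
    (∀ β : Fin m → ℤ, C.IsSuppFloor Q α β → β ∈ C.Hhat Q) ∧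
      (α ∈ C.Hhat Q → C.IsSuppFloor Q α α) := by
  exact ⟨fun β hβ => C.mem_Hhat_of_forall_exists_notMem hQinj (by omega) hq
      hβ.exists_notMem_rrSpace, Curve.isSuppFloor_self_of_mem_Hhat hQinj hα⟩
end
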